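/- arXiv:1910.02508 — 2 statements merged into one kernel-verified Lean document; each statement's English description precedes it below -/
import Mathlib

section
/- There exists a constant C > 0 (depending only on dimension d) such that for all u, v ∈ BV(ℝ^d) with ∫(|u|+|v|)|x| dx < ∞, one has ‖u - v‖_{L¹}² ≤ C ‖u - v‖_{W^{-1,1}} · |D(u-v)|(ℝ^d). -/
open MeasureTheory

section SmoothTestFunctions

variable {E : Type*} [NormedAddCommGroup E] [NormedSpace ℝ E]
  [MeasureSpace E] [BorelSpace E]

/-- Pointwise, the smoothed sign `b / √(b² + η²)` of `b` nearly recovers `|a|` from `a`,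
up to the distance from `a` to `b`. -/
lemma abs_sub_le_mul_div_sqrt (a b : ℝ) {η : ℝ} (hη : 0 < η) :
    |a| - 2 * |a - b| - η ≤ a * (b / √(b ^ 2 + η ^ 2)) := by
  set r := √(b ^ 2 + η ^ 2)
  have hr2 : r ^ 2 = b ^ 2 + η ^ 2 := Real.sq_sqrt (by positivity)
  have hbr : |b| ≤ r := Real.abs_le_sqrt (by nlinarith [sq_nonneg η])
  have hηr : η ≤ r := Real.le_sqrt_of_sq_le (by nlinarith [sq_nonneg b])
  have hr0 : 0 < r := hη.trans_le hηr
  have hsign : |b / r| ≤ 1 := by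
    rw [abs_div, abs_of_pos hr0]
    exact div_le_one_of_le₀ hbr hr0.le
  have hb : |b| - η ≤ b * (b / r) := by
    rw [← mul_div_assoc, le_div_iff₀ hr0]
    nlinarith
  have hab : -|a - b| ≤ (a - b) * (b / r) := by
    have h : |(a - b) * (b / r)| ≤ |a - b| := by
      rw [abs_mul]
      exact mul_le_of_le_one_right (abs_nonneg _) hsign
    exact (abs_le.1 h).1
  have htri : |a| ≤ |a - b| + |b| := by simpa using abs_add_le (a - b) b
  nlinarith

/-- The `L¹` norm is approximated by pairings against `C¹` compactly supported functions bounded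
by one. -/
lemma exists_contDiff_integral_abs_sub_le [FiniteDimensional ℝ E]
    [IsFiniteMeasureOnCompacts (volume : Measure E)]
    {w : E → ℝ} (hw : Integrable w) {δ : ℝ} (hδ : 0 < δ) :
    ∃ s : E → ℝ, ContDiff ℝ 1 s ∧ HasCompactSupport s ∧ (∀ x, |s x| ≤ 1) ∧
      (∫ x, |w x|) - δ ≤ ∫ x, w x * s x := by
  obtain ⟨g, hgc, hg, hgδ⟩ := (memLp_one_iff_integrable.2 hw).exist_eLpNorm_sub_le
    ENNReal.one_ne_top le_rfl (show 0 < δ / 4 by positivity)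
  have hgi : Integrable g := hg.continuous.integrable_of_hasCompactSupport hgc
  have hdist : ∫ x, |w x - g x| ≤ δ / 4 := by
    have h := ENNReal.toReal_mono ENNReal.ofReal_ne_top hgδ
    rw [ENNReal.toReal_ofReal (by positivity)] at h
    have h2 := integral_norm_eq_lintegral_enorm (hw.sub hgi).aestronglyMeasurable
    rw [← eLpNorm_one_eq_lintegral_enorm] at h2
    simp only [Pi.sub_apply, Real.norm_eq_abs] at h2
    rw [h2]
    exact h
  set K := tsupport g
  have hK : MeasurableSet K := (isClosed_tsupport g).measurableSet
  have hKfin : volume K ≠ ⊤ := hgc.measure_lt_top.ne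
  set M := volume.real K
  have hM : 0 ≤ M := measureReal_nonneg
  set η := δ / (4 * (M + 1)) with hη_def
  have hη : 0 < η := by positivity
  have hηM : η * M ≤ δ / 4 := by
    rw [hη_def, div_mul_eq_mul_div, div_le_div_iff₀ (by positivity) (by positivity)]
    nlinarith
  have hpos (x : E) : 0 < g x ^ 2 + η ^ 2 := by positivity
  set s : E → ℝ := fun x => g x / √(g x ^ 2 + η ^ 2) with hs_def
  have hg1 : ContDiff ℝ 1 g := hg.of_le (by exact_mod_cast le_top)
  have hs : ContDiff ℝ 1 s :=
    hg1.div (((hg1.pow 2).add contDiff_const).sqrt fun x => (hpos x).ne')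
      fun x => (Real.sqrt_pos.2 (hpos x)).ne'
  have hsc : HasCompactSupport s := hgc.mono fun x hx h => hx (by simp [hs_def, h])
  have hs1 (x : E) : |s x| ≤ 1 := by
    rw [hs_def, abs_div, abs_of_nonneg (Real.sqrt_nonneg _)]
    exact div_le_one_of_le₀ (Real.abs_le_sqrt (by nlinarith [sq_nonneg η])) (Real.sqrt_nonneg _)
  refine ⟨s, hs, hsc, hs1, ?_⟩
  have hind : Integrable (K.indicator fun _ => η) :=
    (integrable_indicator_iff hK).2 (integrableOn_const hKfin)
  have hpt (x : E) : |w x| - 2 * |w x - g x| - K.indicator (fun _ => η) x ≤ w x * s x := by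
    by_cases hx : x ∈ K
    · simpa [hx] using abs_sub_le_mul_div_sqrt (w x) (g x) hη
    · have hgx : g x = 0 := image_eq_zero_of_notMem_tsupport hx
      simp only [hx, hgx, hs_def, not_false_eq_true, Set.indicator_of_notMem]
      simp only [sub_zero, zero_div, mul_zero]
      linarith [abs_nonneg (w x)]
  have hwg : Integrable fun x => 2 * |w x - g x| := (hw.sub hgi).abs.const_mul 2
  have hint := integral_mono ((hw.abs.sub hwg).sub hind)
    (hw.mul_bdd hs.continuous.aestronglyMeasurable (.of_forall hs1)) hpt
  rw [integral_sub' (hw.abs.sub hwg) hind, integral_sub' hw.abs hwg, integral_const_mul,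
    integral_indicator hK, setIntegral_const, smul_eq_mul, mul_comm M] at hint
  linarith

/-- Mollification at scale `ε` of a function bounded by one yields a `C¹` function whose gradient
is at most `L / ε`, where `L` is the `L¹` norm of the gradient of the mollifier. -/
lemma contDiff_mollify_and_norm_fderiv_le [FiniteDimensional ℝ E]
    [(volume : Measure E).IsAddHaarMeasure]
    {ρ s : E → ℝ} (hρ : ContDiff ℝ 1 ρ) (hρc : HasCompactSupport ρ)
    (hs : Continuous s) (hs1 : ∀ x, |s x| ≤ 1) {ε : ℝ} (hε : 0 < ε) :
    ContDiff ℝ 1 (fun x => ∫ y, ρ y * s (x - ε • y)) ∧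
      ∀ x, ‖fderiv ℝ (fun x => ∫ y, ρ y * s (x - ε • y)) x‖ ≤ (∫ y, ‖fderiv ℝ ρ y‖) / ε := by
  set t : E → ℝ := fun x => s (ε • x)
  have ht : Continuous t := by fun_prop
  set h := convolution ρ t (ContinuousLinearMap.mul ℝ ℝ) volume
  have heq : (fun x => ∫ y, ρ y * s (x - ε • y)) = fun x => h (ε⁻¹ • x) := by
    ext x
    simp [h, t, convolution, smul_sub, smul_smul, hε.ne']
  have hh : ContDiff ℝ 1 h := by
    exact_mod_cast hρc.contDiff_convolution_left (n := 1) (ContinuousLinearMap.mul ℝ ℝ)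
      (by exact_mod_cast hρ) ht.locallyIntegrable
  have hfd (x : E) : ‖fderiv ℝ h x‖ ≤ ∫ y, ‖fderiv ℝ ρ y‖ := by
    rw [(hρc.hasFDerivAt_convolution_left (ContinuousLinearMap.mul ℝ ℝ) hρ
      ht.locallyIntegrable x).fderiv]
    refine norm_integral_le_of_norm_le
      ((hρ.continuous_fderiv one_ne_zero).norm.integrable_of_hasCompactSupport
        (hρc.fderiv (𝕜 := ℝ)).norm) (.of_forall fun y => ?_)
    refine ContinuousLinearMap.opNorm_le_bound _ (norm_nonneg _) fun z => ?_
    rw [ContinuousLinearMap.precompL_apply, ContinuousLinearMap.mul_apply', norm_mul]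
    exact (mul_le_of_le_one_right (norm_nonneg _) (hs1 _)).trans
      ((fderiv ℝ ρ y).le_opNorm z)
  rw [heq]
  refine ⟨hh.comp (contDiff_const_smul _), fun x => ?_⟩
  rw [fderiv_comp_smul, norm_smul, norm_inv, Real.norm_of_nonneg hε.le, div_eq_inv_mul]
  gcongr
  exact hfd _

/-- Averaging against a probability density supported in the unit ball costs at most what the
individual translations cost. -/
lemma integral_mul_sub_mollify_le [FiniteDimensional ℝ E]
    [(volume : Measure E).IsAddHaarMeasure]
    {w ρ s : E → ℝ} (hw : Integrable w) (hρi : Integrable ρ) (hρ0 : ∀ y, 0 ≤ ρ y)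
    (hρ1 : ∫ y, ρ y = 1) (hρs : ∀ y, 1 < ‖y‖ → ρ y = 0)
    (hs : Continuous s) (hs1 : ∀ x, |s x| ≤ 1) {ε B : ℝ}
    (hB : ∀ y, ‖y‖ ≤ 1 → ∫ x, w x * (s x - s (x - ε • y)) ≤ B) :
    (∫ x, w x * s x) - ∫ x, w x * ∫ y, ρ y * s (x - ε • y) ≤ B := by
  have hprod : Integrable (fun p : E × E => w p.1 * ρ p.2) (volume.prod volume) :=
    hw.mul_prod hρi
  have hbound (x y : E) : |s x - s (x - ε • y)| ≤ 2 :=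
    (abs_sub _ _).trans (by linarith [hs1 x, hs1 (x - ε • y)])
  have hF : Integrable (Function.uncurry fun x y => w x * ρ y * (s x - s (x - ε • y)))
      (volume.prod volume) :=
    hprod.mul_bdd (c := 2) (Continuous.aestronglyMeasurable (by fun_prop))
      (.of_forall fun p => hbound p.1 p.2)
  have hinner (x : E) : ∫ y, w x * ρ y * (s x - s (x - ε • y))
      = w x * s x - w x * ∫ y, ρ y * s (x - ε • y) := by
    have hi : Integrable fun y => ρ y * s (x - ε • y) :=
      hρi.mul_bdd (c := 1) (Continuous.aestronglyMeasurable (by fun_prop))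
        (.of_forall fun y => hs1 _)
    simp only [mul_assoc, mul_sub]
    rw [integral_sub ((hρi.mul_const _).const_mul _) (hi.const_mul _), integral_const_mul,
      integral_const_mul, integral_mul_const, hρ1, one_mul]
  have hws : Integrable fun x => w x * s x :=
    hw.mul_bdd hs.aestronglyMeasurable (.of_forall hs1)
  have hdiff := hF.integral_prod_left
  simp only [Function.uncurry_apply_pair, hinner] at hdiff
  have hwm : Integrable fun x => w x * ∫ y, ρ y * s (x - ε • y) := by
    simpa [Pi.sub_def] using hws.sub hdiff
  rw [← integral_sub hws hwm]
  simp only [← hinner]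
  rw [integral_integral_swap hF]
  calc ∫ y, ∫ x, w x * ρ y * (s x - s (x - ε • y)) ≤ ∫ y, ρ y * B := by
        refine integral_mono hF.integral_prod_right (hρi.mul_const B) fun y => ?_
        have hy : ∫ x, w x * ρ y * (s x - s (x - ε • y))
            = ρ y * ∫ x, w x * (s x - s (x - ε • y)) := by
          rw [← integral_const_mul]
          exact integral_congr_ae (.of_forall fun x => by ring)
        simp only [hy]
        rcases le_or_gt ‖y‖ 1 with h | h
        · exact mul_le_mul_of_nonneg_left (hB y h) (hρ0 y)
        · simp [hρs y h]
    _ = B := by rw [integral_mul_const, hρ1, one_mul]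

/-- If every directional derivative of an admissible function pairs with `w` to at most `V`, then
translating an admissible function by `ε • y` changes its pairing with `w` by at most `V * ε`. -/
lemma integral_mul_sub_translate_le
    {w s : E → ℝ} (hw : Integrable w) (hs : ContDiff ℝ 1 s) (hsc : HasCompactSupport s)
    (hs1 : ∀ x, |s x| ≤ 1) {y : E} {V ε : ℝ} (hε : 0 ≤ ε)
    (hV : ∀ ψ : E → ℝ, ContDiff ℝ 1 ψ → HasCompactSupport ψ → (∀ x, |ψ x| ≤ 1) →
      ∫ x, w x * fderiv ℝ ψ x y ≤ V) :
    ∫ x, w x * (s x - s (x - ε • y)) ≤ V * ε := by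
  have hs' : Continuous (fderiv ℝ s) := hs.continuous_fderiv one_ne_zero
  obtain ⟨C, hC⟩ := hs'.bounded_above_of_compact_support (hsc.fderiv (𝕜 := ℝ))
  have hint (t : ℝ) : Integrable fun x => w x * s (x - t • y) :=
    hw.mul_bdd (c := 1) (Continuous.aestronglyMeasurable (by fun_prop))
      (.of_forall fun x => hs1 _)
  have hderiv (t : ℝ) : HasDerivAt (fun t => ∫ x, w x * s (x - t • y))
      (∫ x, w x * -(fderiv ℝ s (x - t • y) y)) t := by
    refine (hasDerivAt_integral_of_dominated_loc_of_deriv_le (s := Set.univ)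
      (F := fun t x => w x * s (x - t • y)) (F' := fun t x => w x * -(fderiv ℝ s (x - t • y) y))
      (bound := fun x => ‖w x‖ * (C * ‖y‖))
      Filter.univ_mem (.of_forall fun t => (hint t).aestronglyMeasurable) (hint t) ?_ ?_
      (hw.norm.mul_const _) ?_).2
    · exact hw.aestronglyMeasurable.mul (Continuous.aestronglyMeasurable (by fun_prop))
    · refine .of_forall fun x t _ => ?_
      rw [norm_mul, norm_neg]
      gcongr
      exact (fderiv ℝ s _).le_of_opNorm_le (hC _) y
    · refine .of_forall fun x t _ => ?_
      have hline : HasDerivAt (fun t : ℝ => x - t • y) (-y) t := by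
        simpa using ((hasDerivAt_id t).smul_const y).const_sub x
      have h := ((hs.differentiable one_ne_zero) (x - t • y)).hasFDerivAt.comp_hasDerivAt t hline
      simpa using h.const_mul (w x)
  have hlower (t : ℝ) : -V ≤ deriv (fun t => ∫ x, w x * s (x - t • y)) t := by
    rw [(hderiv t).deriv]
    simp only [mul_neg, integral_neg, neg_le_neg_iff]
    have h := hV (fun x => s (x - t • y)) (hs.comp (contDiff_id.sub contDiff_const))
      (hsc.comp_homeomorph (Homeomorph.subRight (t • y))) (fun x => hs1 _)
    simpa only [fderiv_comp_sub] using h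
  have h := mul_sub_le_image_sub_of_le_deriv (fun t => (hderiv t).differentiableAt) hlower hε
  have h0 : Integrable fun x => w x * s x := by simpa using hint 0
  simp only [mul_sub]
  rw [integral_sub h0 (hint ε)]
  simp only [zero_smul, sub_zero] at h
  linarith

end SmoothTestFunctions

/-- nonlinear interpolation inequality
`‖u - v‖_{L¹}² ≤ C ‖u - v‖_{W^{-1,1}} |D(u-v)|(ℝ^d)`, where the `W^{-1,1}` norm and
the total variation of `u - v` are encoded through upper bounds `N` and `V` for the
respective dual pairings. -/
theorem nonlinear_interpolation_L1_Wm11_BV (d : ℕ) :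
    ∃ C > (0:ℝ), ∀ (u v : EuclideanSpace ℝ (Fin d) → ℝ) (N V : ℝ),
      Integrable u → Integrable v →
      Integrable (fun x => (|u x| + |v x|) * ‖x‖) →
      (∀ g : EuclideanSpace ℝ (Fin d) → ℝ, ContDiff ℝ 1 g →
        (∀ x, ‖fderiv ℝ g x‖ ≤ 1) → ∫ x, (u x - v x) * g x ≤ N) →
      (∀ φ : EuclideanSpace ℝ (Fin d) → EuclideanSpace ℝ (Fin d),
        ContDiff ℝ 1 φ → HasCompactSupport φ → (∀ x, ‖φ x‖ ≤ 1) →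
        ∫ x, (u x - v x) * (∑ i, fderiv ℝ φ x (EuclideanSpace.single i 1) i) ≤ V) →
      (∫ x, |u x - v x|) ^ 2 ≤ C * N * V := by
  let β : ContDiffBump (0 : EuclideanSpace ℝ (Fin d)) := ⟨1 / 2, 1, by norm_num, by norm_num⟩
  set ρ := β.normed volume
  have hρ : ContDiff ℝ 1 ρ := by exact_mod_cast β.contDiff_normed (n := 1)
  set L := (∫ y, ‖fderiv ℝ ρ y‖) + 1
  have hL : 0 < L := add_pos_of_nonneg_of_pos (integral_nonneg fun _ => norm_nonneg _) one_pos
  refine ⟨4 * L, by positivity, fun u v N V hu hv _ hN hV => ?_⟩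
  set w : EuclideanSpace ℝ (Fin d) → ℝ := fun x => u x - v x
  have hw : Integrable w := hu.sub hv
  have hV' (y : EuclideanSpace ℝ (Fin d)) (hy : ‖y‖ ≤ 1) (ψ : EuclideanSpace ℝ (Fin d) → ℝ)
      (hψ : ContDiff ℝ 1 ψ) (hψc : HasCompactSupport ψ) (hψ1 : ∀ x, |ψ x| ≤ 1) :
      ∫ x, w x * fderiv ℝ ψ x y ≤ V := by
    have h := hV (fun x => ψ x • y) (hψ.smul contDiff_const) hψc.smul_right fun x => by
      rw [norm_smul]
      exact mul_le_one₀ (hψ1 x) (norm_nonneg _) hy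
    refine le_of_eq_of_le (integral_congr_ae (.of_forall fun x => ?_)) h
    have hd := ((hψ.differentiable one_ne_zero) x).hasFDerivAt.smul_const y
    simp only [hd.fderiv]
    congr 1
    conv_lhs => rw [← (EuclideanSpace.basisFun (Fin d) ℝ).sum_repr y]
    simp [mul_comm]
  have hkey {ε : ℝ} (hε : 0 < ε) : ∫ x, |w x| ≤ L / ε * N + V * ε := by
    refine le_of_forall_pos_le_add fun δ hδ => ?_
    obtain ⟨s, hs, hsc, hs1, hsδ⟩ := exists_contDiff_integral_abs_sub_le hw hδ
    have hclose := integral_mul_sub_mollify_le hw β.integrable_normed β.nonneg_normed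
      β.integral_normed
      (fun y hy => Function.notMem_support.1 (by
        rw [β.support_normed_eq, mem_ball_zero_iff]
        exact hy.not_gt))
      hs.continuous hs1
      (fun y hy => integral_mul_sub_translate_le hw hs hsc hs1 hε.le (hV' y hy))
    obtain ⟨hm, hm'⟩ := contDiff_mollify_and_norm_fderiv_le hρ β.hasCompactSupport_normed
      hs.continuous hs1 hε
    set m := fun x => ∫ y, ρ y * s (x - ε • y)
    have hmN := hN (fun x => (ε / L) * m x) (contDiff_const.mul hm) fun x => by
      rw [fderiv_const_mul (hm.differentiable one_ne_zero x), norm_smul,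
        Real.norm_of_nonneg (by positivity)]
      calc ε / L * ‖fderiv ℝ m x‖ ≤ ε / L * (L / ε) := by
            gcongr
            exact (hm' x).trans (by gcongr; simp [L])
        _ = 1 := by field_simp
    have hpull : ∫ x, w x * (ε / L * m x) = ε / L * ∫ x, w x * m x := by
      rw [← integral_const_mul]
      exact integral_congr_ae (.of_forall fun x => by ring)
    have hmN' : ∫ x, w x * m x ≤ L / ε * N := by
      have h := mul_le_mul_of_nonneg_left (hpull.symm.trans_le hmN) (by positivity : 0 ≤ L / ε)
      rwa [← mul_assoc, div_mul_div_cancel₀ hε.ne', div_self hL.ne', one_mul] at h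
    linarith
  have hN0 : 0 ≤ N := by simpa using hN (fun _ => 0) contDiff_const (by simp)
  have hV0 : 0 ≤ V := by
    simpa using hV (fun _ => 0) contDiff_const HasCompactSupport.zero (by simp)
  have hA : 0 ≤ ∫ x, |w x| := integral_nonneg fun _ => abs_nonneg _
  have hquad (ε : ℝ) : 0 ≤ V * (ε * ε) + -(∫ x, |w x|) * ε + L * N := by
    rcases le_or_gt ε 0 with h | h
    · nlinarith [mul_nonneg hV0 (mul_self_nonneg ε), mul_nonneg hL.le hN0,
        mul_nonneg hA (neg_nonneg.2 h)]
    · have := mul_le_mul_of_nonneg_right (hkey h) h.le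
      have e : (L / ε * N + V * ε) * ε = L * N + V * (ε * ε) := by field_simp
      linarith
  have hdisc := discrim_le_zero hquad
  rw [discrim] at hdisc
  linarith
end

section
/- For two sets of finite perimeter E, F ⊆ ℝ^d with ∫_{E ∪ F} |x| dx < ∞, one has |E △ F| ≤ C √(P(E) + P(F)) · √(W₁(χ_E, χ_F)) for a dimensional constant C, where W₁ is the 1-Wasserstein distance between the measures χ_E dx and χ_F dx (assumed to have equal total mass). -/
open MeasureTheory Set

/-- `P` bounds the perimeter of `S` in its dual formulation. -/
def PerimeterLE {d : ℕ} (S : Set (EuclideanSpace ℝ (Fin d))) (P : ℝ) : Prop :=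
  ∀ φ : EuclideanSpace ℝ (Fin d) → EuclideanSpace ℝ (Fin d),
    ContDiff ℝ 1 φ → HasCompactSupport φ → (∀ x, ‖φ x‖ ≤ 1) →
    -∫ x in S, (∑ i, fderiv ℝ φ x (EuclideanSpace.single i 1) i) ≤ P

theorem PerimeterLE.nonneg {d : ℕ} {S : Set (EuclideanSpace ℝ (Fin d))} {P : ℝ}
    (hP : PerimeterLE S P) : 0 ≤ P := by
  simpa using hP (fun _ => 0) contDiff_const HasCompactSupport.zero (by simp)

/-- Testing the perimeter against fields of constant direction. -/
theorem PerimeterLE.neg_setIntegral_fderiv_le {d : ℕ} {S : Set (EuclideanSpace ℝ (Fin d))} {P : ℝ}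
    (hP : PerimeterLE S P) {ψ : EuclideanSpace ℝ (Fin d) → ℝ} (hψ : ContDiff ℝ 1 ψ)
    (hψc : HasCompactSupport ψ) (hψ1 : ∀ x, |ψ x| ≤ 1) {w : EuclideanSpace ℝ (Fin d)}
    (hw : ‖w‖ ≤ 1) : -∫ x in S, fderiv ℝ ψ x w ≤ P := by
  have h := hP (fun x => ψ x • w) (hψ.smul contDiff_const) hψc.smul_right (fun x => by
    rw [norm_smul, Real.norm_eq_abs]
    exact mul_le_one₀ (hψ1 x) (norm_nonneg _) hw)
  have hdiv : ∀ x, ∑ i, fderiv ℝ (fun x => ψ x • w) x (EuclideanSpace.single i 1) i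
      = fderiv ℝ ψ x w := by
    intro x
    rw [fderiv_smul_const (hψ.differentiable one_ne_zero x)]
    conv_rhs => rw [← (EuclideanSpace.basisFun (Fin d) ℝ).sum_repr w, map_sum]
    simp [mul_comm]
  simpa only [hdiv] using h

theorem PerimeterLE.setIntegral_sub_translate_le {d : ℕ} {S : Set (EuclideanSpace ℝ (Fin d))}
    {P : ℝ} (hP : PerimeterLE S P) (hSf : volume S < ⊤)
    {ψ : EuclideanSpace ℝ (Fin d) → ℝ} (hψ : ContDiff ℝ 1 ψ)
    (hψc : HasCompactSupport ψ) (hψ1 : ∀ x, |ψ x| ≤ 1) (v : EuclideanSpace ℝ (Fin d)) :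
    ∫ x in S, (ψ x - ψ (x + v)) ≤ ‖v‖ * P := by
  obtain ⟨w, hw, hv⟩ : ∃ w : EuclideanSpace ℝ (Fin d), ‖w‖ ≤ 1 ∧ v = ‖v‖ • w := by
    rcases eq_or_ne v 0 with rfl | hv
    · exact ⟨0, by simp⟩
    · exact ⟨‖v‖⁻¹ • v, by rw [norm_smul, norm_inv, norm_norm, inv_mul_cancel₀ (norm_ne_zero_iff.2 hv)],
        by rw [smul_inv_smul₀ (norm_ne_zero_iff.2 hv)]⟩
  have : IsFiniteMeasure (volume.restrict S) := ⟨by simpa using hSf⟩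
  have hint : ∀ z, Integrable (fun x => ψ (x + z)) (volume.restrict S) := fun z =>
    .of_bound (hψ.continuous.comp (continuous_add_const z)).aestronglyMeasurable 1
      (.of_forall fun x => hψ1 _)
  have hcont : Continuous (fun x => fderiv ℝ ψ x w) :=
    (hψ.continuous_fderiv one_ne_zero).clm_apply continuous_const
  obtain ⟨M, hM⟩ := hcont.bounded_above_of_compact_support (hψc.fderiv_apply ℝ w)
  have hderiv : ∀ t : ℝ, HasDerivAt (fun t : ℝ => ∫ x in S, ψ (x + t • w))
      (∫ x in S, fderiv ℝ ψ (x + t • w) w) t := fun t =>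
    (hasDerivAt_integral_of_dominated_loc_of_deriv_le (bound := fun _ => M)
      (F' := fun t x => fderiv ℝ ψ (x + t • w) w) Filter.univ_mem
      (.of_forall fun s => (hint _).aestronglyMeasurable) (hint _)
      (hcont.comp (continuous_add_const (t • w))).aestronglyMeasurable
      (.of_forall fun x s _ => hM _) (integrable_const _)
      (.of_forall fun x s _ => by
        have h1 : HasDerivAt (fun s : ℝ => x + s • w) w s := by
          simpa using ((hasDerivAt_id s).smul_const w).const_add x
        exact ((hψ.differentiable one_ne_zero _).hasFDerivAt.comp_hasDerivAt s h1))).2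
  have hle : ∀ t : ℝ, -∫ x in S, fderiv ℝ ψ (x + t • w) w ≤ P := fun t => by
    have h := hP.neg_setIntegral_fderiv_le (ψ := fun x => ψ (x + t • w))
      (hψ.comp (contDiff_id.add contDiff_const))
      (hψc.comp_homeomorph (Homeomorph.addRight (t • w))) (fun x => hψ1 _) hw
    simpa only [fderiv_comp_add_right] using h
  have h := image_sub_le_mul_sub_of_deriv_le (f := fun t : ℝ => -∫ x in S, ψ (x + t • w))
    (C := P)
    (fun t => (hderiv t).fun_neg.differentiableAt)
    (fun t => by rw [(hderiv t).fun_neg.deriv]; exact hle t) (norm_nonneg v)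
  rw [integral_sub (by simpa using hint 0) (hint v), hv]
  simp only [zero_smul, add_zero, ← hv] at h ⊢
  linarith

theorem exists_contDiff_cutoff {d : ℕ} {K L : Set (EuclideanSpace ℝ (Fin d))}
    (hK : IsCompact K) (hL : IsClosed L) (hKL : Disjoint K L) :
    ∃ ψ : EuclideanSpace ℝ (Fin d) → ℝ, ContDiff ℝ 1 ψ ∧ HasCompactSupport ψ ∧
      (∀ x, ψ x ∈ Icc (0:ℝ) 1) ∧ (∀ x ∈ K, ψ x = 1) ∧ ∀ x ∈ L, ψ x = 0 := by
  obtain ⟨r, hr⟩ := hK.isBounded.subset_ball 0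
  obtain ⟨ψ, hψ, hrange, hsupp, hone⟩ := exists_contMDiff_support_eq_eq_one_iff
    (modelWithCornersSelf ℝ (EuclideanSpace ℝ (Fin d))) (n := 1)
    (Metric.isOpen_ball.inter hL.isOpen_compl) hK.isClosed
    (subset_inter hr (subset_compl_iff_disjoint_right.2 hKL))
  refine ⟨ψ, hψ.contDiff, ?_, fun x => hrange ⟨x, rfl⟩, fun x hx => (hone x).1 hx,
    fun x hx => ?_⟩
  · refine HasCompactSupport.intro (isCompact_closedBall (0 : EuclideanSpace ℝ (Fin d)) r)
      fun x hx => ?_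
    by_contra hne
    have : x ∈ Function.support ψ := hne
    rw [hsupp] at this
    exact hx (Metric.ball_subset_closedBall this.1)
  · by_contra hne
    have : x ∈ Function.support ψ := hne
    rw [hsupp] at this
    exact this.2 hx

/-- The tent function `max (1 - ‖y‖) 0`. -/
noncomputable def tent {d : ℕ} (y : EuclideanSpace ℝ (Fin d)) : ℝ := max (1 - ‖y‖) 0

theorem continuous_tent {d : ℕ} : Continuous (tent (d := d)) := by
  unfold tent; fun_prop

theorem tent_nonneg {d : ℕ} (y : EuclideanSpace ℝ (Fin d)) : 0 ≤ tent y := le_max_right _ _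

theorem tent_eq_zero {d : ℕ} {y : EuclideanSpace ℝ (Fin d)} (hy : 1 ≤ ‖y‖) : tent y = 0 :=
  max_eq_right (by linarith)

theorem hasCompactSupport_tent {d : ℕ} : HasCompactSupport (tent (d := d)) :=
  .intro (isCompact_closedBall 0 1) fun y hy => tent_eq_zero (by
    rw [mem_closedBall_zero_iff, not_le] at hy; exact hy.le)

theorem integrable_tent {d : ℕ} : Integrable (tent (d := d)) :=
  continuous_tent.integrable_of_hasCompactSupport hasCompactSupport_tent

theorem integral_tent_pos {d : ℕ} : 0 < ∫ y, tent (d := d) y :=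
  continuous_tent.integral_pos_of_hasCompactSupport_nonneg_nonzero hasCompactSupport_tent
    tent_nonneg (x := 0) (by simp [tent])

theorem abs_tent_sub_le {d : ℕ} (a b : EuclideanSpace ℝ (Fin d)) :
    |tent a - tent b| ≤ ‖a - b‖ := by
  refine (abs_max_sub_max_le_abs _ _ _).trans ?_
  rw [sub_sub_sub_cancel_left, norm_sub_rev]
  exact abs_norm_sub_norm_le b a

theorem integral_abs_tent_sub_le {d : ℕ} (a b : EuclideanSpace ℝ (Fin d)) :
    ∫ z, |tent (z - a) - tent (z - b)| ≤
      2 * volume.real (Metric.ball (0 : EuclideanSpace ℝ (Fin d)) 1) * ‖a - b‖ := by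
  have hind : ∀ a : EuclideanSpace ℝ (Fin d),
      Integrable ((Metric.ball a 1).indicator fun _ => (1:ℝ)) := fun a =>
    (integrable_indicator_iff measurableSet_ball).2 (integrableOn_const measure_ball_lt_top.ne)
  have hvol : ∀ a : EuclideanSpace ℝ (Fin d), ∫ z, (Metric.ball a 1).indicator (fun _ => (1:ℝ)) z
      = volume.real (Metric.ball (0 : EuclideanSpace ℝ (Fin d)) 1) := fun a => by
    rw [integral_indicator measurableSet_ball, setIntegral_const, smul_eq_mul, mul_one,
      measureReal_def, measureReal_def, Measure.addHaar_ball_center]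
  calc ∫ z, |tent (z - a) - tent (z - b)|
      ≤ ∫ z, ‖a - b‖ * ((Metric.ball a 1).indicator (fun _ => (1:ℝ)) z
          + (Metric.ball b 1).indicator (fun _ => (1:ℝ)) z) := by
        refine integral_mono_of_nonneg (.of_forall fun z => abs_nonneg _)
          (((hind a).add (hind b)).const_mul _) (.of_forall fun z => ?_)
        have hle : |tent (z - a) - tent (z - b)| ≤ ‖a - b‖ := by
          refine (abs_tent_sub_le _ _).trans_eq ?_
          rw [sub_sub_sub_cancel_left, norm_sub_rev]
        have hnn := norm_nonneg (a - b)
        by_cases ha : z ∈ Metric.ball a 1 <;> by_cases hb : z ∈ Metric.ball b 1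
        · simp only [indicator_of_mem ha, indicator_of_mem hb]; linarith
        · simp only [indicator_of_mem ha, indicator_of_notMem hb]; linarith
        · simp only [indicator_of_notMem ha, indicator_of_mem hb]; linarith
        · rw [mem_ball_iff_norm, not_lt] at ha hb
          simp only [tent_eq_zero ha, tent_eq_zero hb, sub_self, abs_zero]
          exact mul_nonneg hnn (add_nonneg (indicator_nonneg (by simp) _)
            (indicator_nonneg (by simp) _))
    _ = _ := by
        rw [integral_const_mul, integral_add (hind a) (hind b), hvol, hvol]; ring

theorem lipschitzWith_tent_average {d : ℕ} {ψ : EuclideanSpace ℝ (Fin d) → ℝ}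
    (hψ : Continuous ψ) (hψ1 : ∀ x, |ψ x| ≤ 1) {ε : ℝ} (hε : 0 < ε) :
    LipschitzWith (2 * volume.real (Metric.ball (0 : EuclideanSpace ℝ (Fin d)) 1) / ε).toNNReal
      (fun x => ∫ y, tent y * ψ (x + ε • y)) := by
  have hshift : ∀ x, ∫ y, tent y * ψ (x + ε • y) = ∫ z, tent (z - ε⁻¹ • x) * ψ (ε • z) := by
    intro x
    rw [← integral_sub_right_eq_self _ (ε⁻¹ • x)]
    simp [smul_sub, smul_inv_smul₀ hε.ne']
  have hint : ∀ a, Integrable fun z => tent (z - a) * ψ (ε • z) := fun a =>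
    (integrable_tent.comp_sub_right a).mul_bdd (c := 1)
      (hψ.comp (continuous_const_smul ε)).aestronglyMeasurable (.of_forall fun z => hψ1 _)
  refine LipschitzWith.of_dist_le_mul fun x x' => ?_
  rw [Real.coe_toNNReal _ (by positivity), Real.dist_eq, hshift, hshift,
    ← integral_sub (hint _) (hint _)]
  calc |∫ z, (tent (z - ε⁻¹ • x) * ψ (ε • z) - tent (z - ε⁻¹ • x') * ψ (ε • z))|
      ≤ ∫ z, |tent (z - ε⁻¹ • x) * ψ (ε • z) - tent (z - ε⁻¹ • x') * ψ (ε • z)| :=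
        abs_integral_le_integral_abs
    _ ≤ ∫ z, |tent (z - ε⁻¹ • x) - tent (z - ε⁻¹ • x')| := by
        refine integral_mono_of_nonneg (.of_forall fun z => abs_nonneg _)
          ((integrable_tent.comp_sub_right _).sub (integrable_tent.comp_sub_right _)).abs
          (.of_forall fun z => ?_)
        simp only [← sub_mul, abs_mul]
        exact mul_le_of_le_one_right (abs_nonneg _) (hψ1 _)
    _ ≤ _ := integral_abs_tent_sub_le _ _
    _ = _ := by
        rw [← smul_sub, norm_smul, norm_inv, Real.norm_of_nonneg hε.le, dist_eq_norm]; ring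

/-- Splitting `ψ` into a Lipschitz average at scale `ε` and a remainder. -/
theorem integral_mul_le_of_translate_of_lipschitz {d : ℕ} {u ψ : EuclideanSpace ℝ (Fin d) → ℝ}
    {P W ε : ℝ} (hu : Integrable u) (hψ : Continuous ψ) (hψ1 : ∀ x, |ψ x| ≤ 1) (hε : 0 < ε)
    (hP0 : 0 ≤ P) (hP : ∀ v, ∫ x, u x * (ψ x - ψ (x + v)) ≤ ‖v‖ * P)
    (hW : ∀ g : EuclideanSpace ℝ (Fin d) → ℝ, LipschitzWith 1 g → ∫ x, u x * g x ≤ W) :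
    (∫ y, tent (d := d) y) * ∫ x, u x * ψ x ≤ ε * P * (∫ y, tent (d := d) y) +
      2 * volume.real (Metric.ball (0 : EuclideanSpace ℝ (Fin d)) 1) / ε * W := by
  set c := ∫ y, tent (d := d) y
  set L := 2 * volume.real (Metric.ball (0 : EuclideanSpace ℝ (Fin d)) 1) / ε
  have hL : 0 < L := by
    have : 0 < volume.real (Metric.ball (0 : EuclideanSpace ℝ (Fin d)) 1) :=
      ENNReal.toReal_pos (Metric.measure_ball_pos _ _ one_pos).ne' measure_ball_lt_top.ne
    positivity
  set g := fun x => ∫ y, tent y * ψ (x + ε • y)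
  have hgL : LipschitzWith L.toNNReal g := lipschitzWith_tent_average hψ hψ1 hε
  have htψ : ∀ x, Integrable fun y => tent y * ψ (x + ε • y) := fun x =>
    integrable_tent.mul_bdd (c := 1) (by fun_prop) (.of_forall fun z => hψ1 _)
  have hg1 : ∀ x, |g x| ≤ c := fun x => by
    refine abs_integral_le_integral_abs.trans (integral_mono (htψ x).abs integrable_tent fun y => ?_)
    simp only [abs_mul, abs_of_nonneg (tent_nonneg y)]
    exact mul_le_of_le_one_right (tent_nonneg y) (hψ1 _)
  have huψ : Integrable fun x => u x * ψ x :=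
    hu.mul_bdd (c := 1) hψ.aestronglyMeasurable (.of_forall hψ1)
  have hug : Integrable fun x => u x * g x :=
    hu.mul_bdd (c := c) hgL.continuous.aestronglyMeasurable (.of_forall hg1)
  have hWg : ∫ x, u x * g x ≤ L * W := by
    have h := hW (fun x => L⁻¹ * g x) (LipschitzWith.of_dist_le_mul fun x y => by
      have h2 := hgL.dist_le_mul x y
      rw [Real.coe_toNNReal _ hL.le, Real.dist_eq] at h2
      rw [Real.dist_eq, ← mul_sub, abs_mul, abs_of_pos (inv_pos.2 hL), NNReal.coe_one, one_mul,
        inv_mul_le_iff₀ hL]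
      exact h2)
    simp only [mul_left_comm (u _) L⁻¹, integral_const_mul] at h
    rwa [inv_mul_le_iff₀ hL] at h
  have hprod : Integrable (Function.uncurry fun x y => u x * (tent y * (ψ x - ψ (x + ε • y))))
      (volume.prod volume) := by
    have h := (hu.mul_prod (integrable_tent (d := d))).mul_bdd (c := 2)
      (g := fun p : EuclideanSpace ℝ (Fin d) × EuclideanSpace ℝ (Fin d) =>
        ψ p.1 - ψ (p.1 + ε • p.2)) (by fun_prop)
      (.of_forall fun p => (abs_sub _ _).trans (by linarith [hψ1 p.1, hψ1 (p.1 + ε • p.2)]))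
    refine h.congr (.of_forall fun p => ?_)
    simp only [Function.uncurry]; ring
  have hrem : ∫ x, u x * (c * ψ x - g x) ≤ ε * P * c := by
    calc ∫ x, u x * (c * ψ x - g x)
        = ∫ x, ∫ y, u x * (tent y * (ψ x - ψ (x + ε • y))) := by
          refine integral_congr_ae (.of_forall fun x => ?_)
          simp only [integral_const_mul, mul_sub (tent _)]
          rw [integral_sub (integrable_tent.mul_const _) (htψ x), integral_mul_const]
      _ = ∫ y, ∫ x, u x * (tent y * (ψ x - ψ (x + ε • y))) := integral_integral_swap hprod
      _ ≤ ∫ y, ε * P * tent y := by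
          refine integral_mono hprod.integral_prod_right (integrable_tent.const_mul _) fun y => ?_
          simp only [mul_left_comm (u _) (tent y), integral_const_mul]
          rw [mul_comm _ (tent y)]
          rcases le_total 1 ‖y‖ with hy | hy
          · simp [tent_eq_zero hy]
          · refine mul_le_mul_of_nonneg_left ((hP _).trans ?_) (tent_nonneg y)
            rw [norm_smul, Real.norm_of_nonneg hε.le]
            exact mul_le_mul_of_nonneg_right (mul_le_of_le_one_right hε.le hy) hP0
      _ = ε * P * c := integral_const_mul _ _
  have hsplit : c * ∫ x, u x * ψ x = (∫ x, u x * (c * ψ x - g x)) + ∫ x, u x * g x := by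
    have : ∀ x, u x * (c * ψ x - g x) = c * (u x * ψ x) - u x * g x := fun x => by ring
    simp only [this]
    rw [integral_sub (huψ.const_mul c) hug, integral_const_mul]; ring
  linarith

theorem le_sqrt_mul_sqrt_of_forall_pos {m p q : ℝ} (hm : 0 ≤ m) (hp : 0 ≤ p) (hq : 0 ≤ q)
    (h : ∀ ε > 0, m ≤ ε * p + q / ε) : m ≤ 2 * √p * √q := by
  have hd := discrim_le_zero (a := p) (b := -m) (c := q) fun x => by
    rcases le_or_gt x 0 with hx | hx
    · nlinarith [mul_nonneg hp (mul_self_nonneg x),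
        mul_nonneg_of_nonpos_of_nonpos hx (neg_nonpos.2 hm)]
    · have h1 := mul_le_mul_of_nonneg_right (h x hx) hx.le
      rw [add_mul, div_mul_cancel₀ _ hx.ne'] at h1
      linarith
  refine le_of_sq_le_sq ?_ (by positivity)
  rw [mul_pow, mul_pow, Real.sq_sqrt hp, Real.sq_sqrt hq]
  rw [discrim] at hd
  linarith

/-- For measurable sets of finite measure, `χ_E - χ_F` is almost its own sign against a
compactly supported `C¹` function. -/
theorem exists_contDiff_measureReal_symmDiff_le {d : ℕ} {E F : Set (EuclideanSpace ℝ (Fin d))}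
    (hE : MeasurableSet E) (hF : MeasurableSet F) (hEf : volume E < ⊤) (hFf : volume F < ⊤)
    {δ : ℝ} (hδ : 0 < δ) :
    ∃ ψ : EuclideanSpace ℝ (Fin d) → ℝ, ContDiff ℝ 1 ψ ∧ HasCompactSupport ψ ∧
      (∀ x, |ψ x| ≤ 1) ∧ (volume (symmDiff E F)).toReal - 4 * δ ≤
        ∫ x, (E.indicator (fun _ => (1:ℝ)) x - F.indicator (fun _ => (1:ℝ)) x) * ψ x := by
  have hA : volume (E \ F) ≠ ⊤ := measure_ne_top_of_subset sdiff_subset hEf.ne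
  have hB : volume (F \ E) ≠ ⊤ := measure_ne_top_of_subset sdiff_subset hFf.ne
  have hδ' : ENNReal.ofReal δ ≠ 0 := (ENNReal.ofReal_pos.2 hδ).ne'
  obtain ⟨K, hKE, hK, hKδ⟩ := (hE.diff hF).exists_isCompact_sdiff_lt hA hδ'
  obtain ⟨L, hLF, hL, hLδ⟩ := (hF.diff hE).exists_isCompact_sdiff_lt hB hδ'
  have hKL : Disjoint K L := disjoint_left.2 fun x hx hx' => (hKE hx).2 (hLF hx').1
  obtain ⟨f, hf, hfc, hf01, hfK, hfL⟩ := exists_contDiff_cutoff hK hL.isClosed hKL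
  obtain ⟨g, hg, hgc, hg01, hgL, hgK⟩ := exists_contDiff_cutoff hL hK.isClosed hKL.symm
  have hfg1 : ∀ x, |f x - g x| ≤ 1 := fun x => abs_le.2
    ⟨by linarith [(hf01 x).1, (hg01 x).2], by linarith [(hf01 x).2, (hg01 x).1]⟩
  refine ⟨fun x => f x - g x, hf.sub hg, hfc.sub hgc, hfg1, ?_⟩
  have hind : ∀ {S : Set (EuclideanSpace ℝ (Fin d))}, MeasurableSet S → volume S ≠ ⊤ →
      Integrable (S.indicator fun _ => (1:ℝ)) := fun hS hSf =>
    (integrable_indicator_iff hS).2 (integrableOn_const hSf)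
  have hvol : ∀ {S : Set (EuclideanSpace ℝ (Fin d))}, MeasurableSet S →
      ∫ x, S.indicator (fun _ => (1:ℝ)) x = volume.real S := fun hS => by
    rw [integral_indicator hS, setIntegral_const, smul_eq_mul, mul_one]
  have hAK := hind ((hE.diff hF).diff hK.measurableSet)
    (measure_ne_top_of_subset sdiff_subset hA)
  have hBL := hind ((hF.diff hE).diff hL.measurableSet)
    (measure_ne_top_of_subset sdiff_subset hB)
  have hiA := hind (hE.diff hF) hA
  have hiB := hind (hF.diff hE) hB
  have hKδ' : volume.real ((E \ F) \ K) ≤ δ := ENNReal.toReal_le_of_le_ofReal hδ.le hKδ.le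
  have hLδ' : volume.real ((F \ E) \ L) ≤ δ := ENNReal.toReal_le_of_le_ofReal hδ.le hLδ.le
  have hsymm : (volume (symmDiff E F)).toReal = volume.real (E \ F) + volume.real (F \ E) :=
    measureReal_union disjoint_sdiff_sdiff (hF.diff hE) hA hB
  have hpt : ∀ x, (E \ F).indicator (fun _ => (1:ℝ)) x + (F \ E).indicator (fun _ => (1:ℝ)) x -
      (2 * ((E \ F) \ K).indicator (fun _ => (1:ℝ)) x +
        2 * ((F \ E) \ L).indicator (fun _ => (1:ℝ)) x) ≤
      (E.indicator (fun _ => (1:ℝ)) x - F.indicator (fun _ => (1:ℝ)) x) * (f x - g x) := by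
    intro x
    classical
    have h1 := abs_le.1 (hfg1 x)
    simp only [indicator_apply, mem_sdiff]
    by_cases hxE : x ∈ E <;> by_cases hxF : x ∈ F
    · simp [hxE, hxF]
    · by_cases hxK : x ∈ K
      · simp [hxE, hxF, hxK, hfK x hxK, hgK x hxK]
      · simp only [hxE, hxF, hxK, not_true_eq_false, not_false_eq_true, and_self,
          false_and, if_true, if_false]
        linarith
    · by_cases hxL : x ∈ L
      · simp [hxE, hxF, hxL, hfL x hxL, hgL x hxL]
      · simp only [hxE, hxF, hxL, not_true_eq_false, not_false_eq_true, and_self,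
          false_and, if_true, if_false]
        linarith
    · simp [hxE, hxF]
  have hmono := integral_mono
    ((hiA.add hiB).sub ((hAK.const_mul 2).add (hBL.const_mul 2)))
    (((hind hE hEf.ne).sub (hind hF hFf.ne)).mul_bdd (c := 1) (g := fun x => f x - g x)
      (hf.continuous.sub hg.continuous).aestronglyMeasurable (.of_forall hfg1)) hpt
  rw [integral_sub' (hiA.add hiB) ((hAK.const_mul 2).add (hBL.const_mul 2)),
    integral_add' hiA hiB, integral_add' (hAK.const_mul 2) (hBL.const_mul 2), integral_const_mul,
    integral_const_mul, hvol (hE.diff hF), hvol (hF.diff hE),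
    hvol ((hE.diff hF).diff hK.measurableSet), hvol ((hF.diff hE).diff hL.measurableSet)] at hmono
  refine le_trans ?_ hmono
  linarith

theorem integral_indicator_sub_mul_translate_le {d : ℕ} {E F : Set (EuclideanSpace ℝ (Fin d))}
    {PE PF : ℝ} (hE : MeasurableSet E) (hF : MeasurableSet F) (hEf : volume E < ⊤)
    (hFf : volume F < ⊤) (hPE : PerimeterLE E PE) (hPF : PerimeterLE F PF)
    {ψ : EuclideanSpace ℝ (Fin d) → ℝ} (hψ : ContDiff ℝ 1 ψ) (hψc : HasCompactSupport ψ)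
    (hψ1 : ∀ x, |ψ x| ≤ 1) (v : EuclideanSpace ℝ (Fin d)) :
    ∫ x, (E.indicator (fun _ => (1:ℝ)) x - F.indicator (fun _ => (1:ℝ)) x) *
      (ψ x - ψ (x + v)) ≤ ‖v‖ * (PE + PF) := by
  have hint : Integrable fun x => ψ x - ψ (x + v) := by
    have h := hψ.continuous.integrable_of_hasCompactSupport (μ := volume) hψc
    exact h.sub (h.comp_add_right v)
  have h1 := hPE.setIntegral_sub_translate_le hEf hψ hψc hψ1 v
  have h2 := hPF.setIntegral_sub_translate_le hFf (ψ := fun x => -ψ x) hψ.neg hψc.neg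
    (fun x => by simpa using hψ1 x) v
  have h3 : ∀ x, -ψ x - -ψ (x + v) = -(ψ x - ψ (x + v)) := fun x => by ring
  simp only [h3, integral_neg] at h2
  have hmul : ∀ x, (E.indicator (fun _ => (1:ℝ)) x - F.indicator (fun _ => (1:ℝ)) x) *
      (ψ x - ψ (x + v)) = E.indicator (fun x => ψ x - ψ (x + v)) x
        - F.indicator (fun x => ψ x - ψ (x + v)) x := fun x => by
    by_cases hxE : x ∈ E <;> by_cases hxF : x ∈ F <;> simp [hxE, hxF]
  simp only [hmul]
  rw [integral_sub (hint.indicator hE) (hint.indicator hF), integral_indicator hE,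
    integral_indicator hF]
  linarith

/-- For sets of finite perimeter `E, F` with finite first moment and
equal measure, `|E △ F| ≤ C √(P(E) + P(F)) √(W₁(χ_E, χ_F))`, where the perimeters
and the `W₁` distance (via Kantorovich–Rubinstein duality) are encoded through
upper bounds for the corresponding dual pairings. -/
theorem symmDiff_interpolation_perimeter_W1 (d : ℕ) :
    ∃ C > (0:ℝ), ∀ (E F : Set (EuclideanSpace ℝ (Fin d))) (PE PF W1 : ℝ),
      MeasurableSet E → MeasurableSet F →
      volume E < ⊤ → volume F < ⊤ → volume E = volume F →
      IntegrableOn (fun x => ‖x‖) (E ∪ F) volume →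
      (∀ φ : EuclideanSpace ℝ (Fin d) → EuclideanSpace ℝ (Fin d),
        ContDiff ℝ 1 φ → HasCompactSupport φ → (∀ x, ‖φ x‖ ≤ 1) →
        -∫ x in E, (∑ i, fderiv ℝ φ x (EuclideanSpace.single i 1) i) ≤ PE) →
      (∀ φ : EuclideanSpace ℝ (Fin d) → EuclideanSpace ℝ (Fin d),
        ContDiff ℝ 1 φ → HasCompactSupport φ → (∀ x, ‖φ x‖ ≤ 1) →
        -∫ x in F, (∑ i, fderiv ℝ φ x (EuclideanSpace.single i 1) i) ≤ PF) →
      (∀ g : EuclideanSpace ℝ (Fin d) → ℝ, LipschitzWith 1 g →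
        ∫ x, (E.indicator (fun _ => (1:ℝ)) x - F.indicator (fun _ => (1:ℝ)) x) * g x ≤ W1) →
      (volume (symmDiff E F)).toReal ≤ C * Real.sqrt (PE + PF) * Real.sqrt W1 := by
  set c := ∫ y, tent (d := d) y
  have hc : 0 < c := integral_tent_pos
  set k := 2 * volume.real (Metric.ball (0 : EuclideanSpace ℝ (Fin d)) 1)
  have hk : 0 < k := mul_pos two_pos
    (ENNReal.toReal_pos (Metric.measure_ball_pos _ _ one_pos).ne' measure_ball_lt_top.ne)
  refine ⟨2 * √(k / c), by positivity, fun E F PE PF W hE hF hEf hFf _ _ hPE hPF hW => ?_⟩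
  have hP0 : 0 ≤ PE + PF := add_nonneg (PerimeterLE.nonneg hPE) (PerimeterLE.nonneg hPF)
  have hW0 : 0 ≤ W := by simpa using hW (fun _ => 0) (LipschitzWith.const' 0)
  have hu : Integrable fun x => E.indicator (fun _ => (1:ℝ)) x - F.indicator (fun _ => (1:ℝ)) x :=
    ((integrable_indicator_iff hE).2 (integrableOn_const hEf.ne)).sub
      ((integrable_indicator_iff hF).2 (integrableOn_const hFf.ne))
  have key : ∀ ε > 0, (volume (symmDiff E F)).toReal ≤ ε * (PE + PF) + (k / c * W) / ε := by
    intro ε hε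
    refine le_of_forall_pos_le_add fun δ hδ => ?_
    obtain ⟨ψ, hψ, hψc, hψ1, hle⟩ :=
      exists_contDiff_measureReal_symmDiff_le hE hF hEf hFf (δ := δ / 4) (by positivity)
    have h := integral_mul_le_of_translate_of_lipschitz hu hψ.continuous hψ1 hε hP0
      (integral_indicator_sub_mul_translate_le hE hF hEf hFf hPE hPF hψ hψc hψ1) hW
    have h' := (le_div_iff₀' hc).2 h
    have heq : (ε * (PE + PF) * c + k / ε * W) / c = ε * (PE + PF) + (k / c * W) / ε := by
      field_simp
    linarith [h'.trans_eq heq]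
  refine (le_sqrt_mul_sqrt_of_forall_pos ENNReal.toReal_nonneg hP0 (by positivity) key).trans_eq ?_
  rw [Real.sqrt_mul (by positivity)]
  ring
end
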